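/- Preservation of stability under optimization (Lemma 'U to U*'): Let 𝒰 be a measurable correspondence assigning to each (t,x) ∈ ℝ₊ × F a nonempty compact set 𝒰(t,x) ⊆ 𝒫(Ω) such that every P ∈ 𝒰(t,x) satisfies P(X_s = x for all s ≤ t) = 1, and suppose 𝒰 is stable under conditioning and stable under pasting. Then, for every bounded upper semicontinuous φ : F → ℝ and every T > 0, the correspondence 𝒰*(t,x) := {P ∈ 𝒰(t,x) : E^P[φ(X_T)] = sup_{Q ∈ 𝒰(t,x)} E^Q[φ(X_T)]} is again measurable with nonempty compact values and is stable under conditioning and stable under pasting; moreover, if 𝒰 has convex values, then so does 𝒰*. -/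

import Mathlib

open MeasureTheory Set Filter Topology
open scoped NNReal ENNReal

noncomputable section

namespace NLSP

/-- Lebesgue measure on `ℝ≥0`, obtained from Lebesgue measure on `ℝ`. -/
def leb : Measure ℝ≥0 := (volume : Measure ℝ).comap Subtype.val

section PathSpace

variable {F : Type*} [TopologicalSpace F]

/-- The shift map `θ_t ω = ω (· + t)` on the path space `C(ℝ≥0, F)`. -/
def theta (t : ℝ≥0) (ω : C(ℝ≥0, F)) : C(ℝ≥0, F) :=
  ω.comp ⟨fun s => s + t, by fun_prop⟩

/-- The map `γ_t ω = ω ((· - t)⁺)` on the path space `C(ℝ≥0, F)`. -/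
def gammaShift (t : ℝ≥0) (ω : C(ℝ≥0, F)) : C(ℝ≥0, F) :=
  ω.comp ⟨fun s => s - t, by fun_prop⟩

/-- The canonical σ-algebra `𝓕_t = σ(X_s : s ≤ t)` on the path space. -/
def canonicalSig (F : Type*) [TopologicalSpace F] (t : ℝ≥0) :
    MeasurableSpace C(ℝ≥0, F) :=
  ⨆ s ∈ Set.Iic t, MeasurableSpace.comap (fun ω : C(ℝ≥0, F) => ω s) (borel F)

/-- The right-continuous σ-algebra `𝒢^t_s = ⋂_{r > s} σ(X_{v+t} : v ≤ r)` generated by the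
shifted coordinate process. -/
def shiftSig (F : Type*) [TopologicalSpace F] (t s : ℝ≥0) :
    MeasurableSpace C(ℝ≥0, F) :=
  ⨅ r ∈ Set.Ioi s, ⨆ v ∈ Set.Iic r,
    MeasurableSpace.comap (fun ω : C(ℝ≥0, F) => ω (v + t)) (borel F)

end PathSpace

/-- A function `ℝ≥0 → E` is càdlàg if it is right-continuous and has left limits. -/
def Cadlag {E : Type*} [TopologicalSpace E] (f : ℝ≥0 → E) : Prop :=
  (∀ t, ContinuousWithinAt f (Set.Ici t) t) ∧
    ∀ t : ℝ≥0, 0 < t → ∃ l : E, Tendsto f (nhdsWithin t (Set.Iio t)) (nhds l)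

/-- A function is upper semianalytic if its strict superlevel sets are analytic. -/
def UpperSemianalytic {α : Type*} [TopologicalSpace α] (ψ : α → ℝ) : Prop :=
  ∀ c : ℝ, MeasureTheory.AnalyticSet {x | c < ψ x}

section Mart

variable {Ω' : Type*}

/-- `τ` is a stopping time for the filtration `𝒢`. -/
def IsStoppingTimeOn (𝒢 : ℝ≥0 → MeasurableSpace Ω') (τ : Ω' → ℝ≥0) : Prop :=
  ∀ t, MeasurableSet[𝒢 t] {ω | τ ω ≤ t}

/-- `N` is a `P`-martingale for the filtration `𝒢`. -/
def IsMartingaleOn [MeasurableSpace Ω'] (P : Measure Ω')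
    (𝒢 : ℝ≥0 → MeasurableSpace Ω') {E : Type*} [NormedAddCommGroup E] [NormedSpace ℝ E]
    (N : ℝ≥0 → Ω' → E) : Prop :=
  (∀ s, StronglyMeasurable[𝒢 s] (N s)) ∧ (∀ s, Integrable (N s) P) ∧
    ∀ s t : ℝ≥0, s ≤ t → ∀ A : Set Ω', MeasurableSet[𝒢 s] A →
      ∫ ω in A, N t ω ∂P = ∫ ω in A, N s ω ∂P

/-- `N` is a local `P`-martingale for the filtration `𝒢`: there is a localizing
nondecreasing sequence of `𝒢`-stopping times increasing `P`-a.s. to `∞` such that every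
stopped process is a `P`-martingale. -/
def IsLocalMartingaleOn [MeasurableSpace Ω'] (P : Measure Ω')
    (𝒢 : ℝ≥0 → MeasurableSpace Ω') {E : Type*} [NormedAddCommGroup E] [NormedSpace ℝ E]
    (N : ℝ≥0 → Ω' → E) : Prop :=
  ∃ σ : ℕ → Ω' → ℝ≥0,
    (∀ n, IsStoppingTimeOn 𝒢 (σ n)) ∧ (∀ n ω, σ n ω ≤ σ (n + 1) ω) ∧
      (∀ᵐ ω ∂P, Tendsto (fun n => σ n ω) atTop atTop) ∧
      ∀ n, IsMartingaleOn P 𝒢 fun s ω => N (min s (σ n ω)) ω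

/-- Progressive measurability of `a` with respect to the filtration `𝒢`. -/
def ProgMeasOn (𝒢 : ℝ≥0 → MeasurableSpace Ω') {E : Type*} [MeasurableSpace E]
    (a : ℝ≥0 → Ω' → E) : Prop :=
  ∀ s : ℝ≥0,
    @Measurable (ℝ≥0 × Ω') E ((inferInstance : MeasurableSpace ℝ≥0).prod (𝒢 s)) _
      fun p => a (min p.1 s) p.2

end Mart

section Main

variable {F : Type*} [TopologicalSpace F] {𝕂 : Type*} [RCLike 𝕂]
  [MeasurableSpace 𝕂] {U : Type*}

/-- The set `𝒞(t, ω)` of laws under which every test process `Y^u` is a special semimartingale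
(after time `t`) with absolutely continuous compensator whose densities lie in `Θ`. -/
def CSet [MeasurableSpace C(ℝ≥0, F)] (Y : U → ℝ≥0 → C(ℝ≥0, F) → 𝕂)
    (Θ : ℝ≥0 → C(ℝ≥0, F) → Set (U → 𝕂)) (t : ℝ≥0) (ω : C(ℝ≥0, F)) :
    Set (ProbabilityMeasure C(ℝ≥0, F)) :=
  {P | (P : Measure C(ℝ≥0, F)) {ω' | ∀ s ≤ t, ω' s = ω s} = 1 ∧
    ∃ a : U → ℝ≥0 → C(ℝ≥0, F) → 𝕂,
      (∀ u, ProgMeasOn (shiftSig F t) (a u)) ∧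
      (∀ u, ∀ᵐ ω' ∂(P : Measure C(ℝ≥0, F)), ∀ s : ℝ≥0,
        IntegrableOn (fun r => a u r ω') (Set.Iic s) leb) ∧
      (∀ u, IsLocalMartingaleOn (P : Measure C(ℝ≥0, F)) (shiftSig F t)
        fun s ω' => Y u (s + t) ω' - Y u t ω' - ∫ r in Set.Iic s, a u r ω' ∂leb) ∧
      ∀ᵐ p ∂(leb.prod (P : Measure C(ℝ≥0, F))),
        (fun u => a u p.1 p.2) ∈ Θ (p.1 + t) p.2}

/-- The set `ℛ(x) = 𝒞(0, x)` for the Markovian specification `Θ(t, ω) = Θ₀(ω t)`. -/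
def RSet [MeasurableSpace C(ℝ≥0, F)] (Y : U → ℝ≥0 → C(ℝ≥0, F) → 𝕂)
    (Θ₀ : F → Set (U → 𝕂)) (x : F) : Set (ProbabilityMeasure C(ℝ≥0, F)) :=
  CSet Y (fun s ω' => Θ₀ (ω' s)) 0 (ContinuousMap.const ℝ≥0 x)

/-- The set `𝒦(t, x)` for the Markovian specification `Θ(t, ω) = Θ₀(ω t)`. -/
def KSet [MeasurableSpace C(ℝ≥0, F)] (Y : U → ℝ≥0 → C(ℝ≥0, F) → 𝕂)
    (Θ₀ : F → Set (U → 𝕂)) (t : ℝ≥0) (x : F) : Set (ProbabilityMeasure C(ℝ≥0, F)) :=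
  CSet Y (fun s ω' => Θ₀ (ω' s)) t (ContinuousMap.const ℝ≥0 x)

end Main

end NLSP

namespace NLSP

section Conditioning

variable {F : Type*} [TopologicalSpace F]

open Classical in
/-- Concatenation `ω ⊗_t ω'` of two paths: if `ω'(t) = ω(t)` it follows `ω` until time `t`
and `ω'` afterwards; otherwise it is the stopped path `ω(· ∧ t)` (immaterial convention). -/
def concat (t : ℝ≥0) (ω ω' : C(ℝ≥0, F)) : C(ℝ≥0, F) :=
  if h : ω' t = ω t then
    ⟨fun s => if s ≤ t then ω s else ω' s,
      Continuous.if_le ω.continuous ω'.continuous continuous_id continuous_const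
        fun s hs => by rw [hs, h]⟩
  else ω.comp ⟨fun s => min s t, by fun_prop⟩

/-- The σ-algebra `𝓕_τ` of a stopping time `τ` (for a stopping time, the generating family
below is already a σ-algebra). -/
def ftau [MeasurableSpace C(ℝ≥0, F)] (τ : C(ℝ≥0, F) → ℝ≥0) :
    MeasurableSpace C(ℝ≥0, F) :=
  MeasurableSpace.generateFrom
    {A | MeasurableSet A ∧ ∀ t, MeasurableSet[canonicalSig F t] (A ∩ {ω | τ ω ≤ t})}

/-- `κ` is a regular conditional probability of `P` given `𝓕_τ`. -/
def IsRCP [MeasurableSpace C(ℝ≥0, F)] (P : Measure C(ℝ≥0, F)) (τ : C(ℝ≥0, F) → ℝ≥0)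
    (κ : C(ℝ≥0, F) → Measure C(ℝ≥0, F)) : Prop :=
  (∀ ω, IsProbabilityMeasure (κ ω)) ∧
    (∀ A : Set C(ℝ≥0, F), MeasurableSet A →
      @Measurable _ _ (ftau τ) _ fun ω => κ ω A) ∧
    ∀ A B : Set C(ℝ≥0, F), MeasurableSet A → MeasurableSet[ftau τ] B →
      P (A ∩ B) = ∫⁻ ω in B, κ ω A ∂P

/-- The pasting measure `P ⊗_τ Q`. -/
def pasting [MeasurableSpace C(ℝ≥0, F)] (P : Measure C(ℝ≥0, F)) (τ : C(ℝ≥0, F) → ℝ≥0)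
    (Q : C(ℝ≥0, F) → Measure C(ℝ≥0, F)) : Measure C(ℝ≥0, F) :=
  P.bind fun ω => (Q ω).map fun ω' => concat (τ ω) ω ω'

end Conditioning

end NLSP

namespace NLSP

section Ustar

variable {F : Type*} [TopologicalSpace F] [PolishSpace F]
  [MeasurableSpace F] [BorelSpace F]
  [MeasurableSpace C(ℝ≥0, F)] [BorelSpace C(ℝ≥0, F)]

/-- `δ_y ⊗_t Q`: pasting of the Dirac measure at the constant path `≡ y` with `Q` at time `t`. -/
def pastDirac (t : ℝ≥0) (y : F) (Q : Measure C(ℝ≥0, F)) : Measure C(ℝ≥0, F) :=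
  Q.map fun ω' => concat t (ContinuousMap.const ℝ≥0 y) ω'

/-- A correspondence `𝒰 : ℝ₊ × F ⇉ 𝒫(Ω)` is measurable if the lower inverse of every weakly
closed set is Borel. -/
def MeasCorr (𝒰 : ℝ≥0 → F → Set (ProbabilityMeasure C(ℝ≥0, F))) : Prop :=
  ∀ G : Set (ProbabilityMeasure C(ℝ≥0, F)), IsClosed G →
    MeasurableSet {p : ℝ≥0 × F | (𝒰 p.1 p.2 ∩ G).Nonempty}

/-- Stability under conditioning of a correspondence `𝒰`. -/
def StableCond (𝒰 : ℝ≥0 → F → Set (ProbabilityMeasure C(ℝ≥0, F))) : Prop :=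
  ∀ (t : ℝ≥0) (x : F), ∀ P ∈ 𝒰 t x, ∀ τ : C(ℝ≥0, F) → ℝ≥0,
    IsStoppingTimeOn (canonicalSig F) τ → (∀ ω, t ≤ τ ω) →
    ∀ κ : C(ℝ≥0, F) → Measure C(ℝ≥0, F), IsRCP (P : Measure C(ℝ≥0, F)) τ κ →
    ∃ N : Set C(ℝ≥0, F), MeasurableSet[ftau τ] N ∧ (P : Measure C(ℝ≥0, F)) N = 0 ∧
      ∀ ω ∉ N, ∃ R ∈ 𝒰 (τ ω) (ω (τ ω)),
        (R : Measure C(ℝ≥0, F)) = pastDirac (τ ω) (ω (τ ω)) (κ ω)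

/-- Stability under pasting of a correspondence `𝒰`. -/
def StablePaste (𝒰 : ℝ≥0 → F → Set (ProbabilityMeasure C(ℝ≥0, F))) : Prop :=
  ∀ (t : ℝ≥0) (x : F), ∀ P ∈ 𝒰 t x, ∀ τ : C(ℝ≥0, F) → ℝ≥0,
    IsStoppingTimeOn (canonicalSig F) τ → (∀ ω, t ≤ τ ω) →
    ∀ Q : C(ℝ≥0, F) → ProbabilityMeasure C(ℝ≥0, F),
    (∀ A : Set C(ℝ≥0, F), MeasurableSet A →
      @Measurable _ _ (ftau τ) _ fun ω => (Q ω : Measure C(ℝ≥0, F)) A) →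
    (∀ᵐ ω ∂(P : Measure C(ℝ≥0, F)), ∃ R ∈ 𝒰 (τ ω) (ω (τ ω)),
      (R : Measure C(ℝ≥0, F)) = pastDirac (τ ω) (ω (τ ω)) (Q ω : Measure C(ℝ≥0, F))) →
    ∃ R ∈ 𝒰 t x,
      (R : Measure C(ℝ≥0, F)) =
        pasting (P : Measure C(ℝ≥0, F)) τ fun ω => (Q ω : Measure C(ℝ≥0, F))

/-- Convexity of the values of a correspondence of probability measures. -/
def ConvexVals (𝒰 : ℝ≥0 → F → Set (ProbabilityMeasure C(ℝ≥0, F))) : Prop :=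
  ∀ (t : ℝ≥0) (x : F), ∀ P ∈ 𝒰 t x, ∀ Q ∈ 𝒰 t x, ∀ α : ℝ, α ∈ Set.Ioo (0 : ℝ) 1 →
    ∃ R ∈ 𝒰 t x,
      (R : Measure C(ℝ≥0, F)) =
        ENNReal.ofReal α • (P : Measure C(ℝ≥0, F)) +
          ENNReal.ofReal (1 - α) • (Q : Measure C(ℝ≥0, F))

/-- The optimized correspondence `𝒰*`. -/
def Ustar (𝒰 : ℝ≥0 → F → Set (ProbabilityMeasure C(ℝ≥0, F))) (φ : F → ℝ) (T : ℝ≥0)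
    (t : ℝ≥0) (x : F) : Set (ProbabilityMeasure C(ℝ≥0, F)) :=
  {P ∈ 𝒰 t x | ∫ ω, φ (ω T) ∂(P : Measure C(ℝ≥0, F)) =
    sSup ((fun Q : ProbabilityMeasure C(ℝ≥0, F) =>
      ∫ ω, φ (ω T) ∂(Q : Measure C(ℝ≥0, F))) '' 𝒰 t x)}

section HelperAbstract

open ProbabilityTheory

variable {α : Type*} [MeasurableSpace α] {E : Type*} [TopologicalSpace E]

/-- Measurable correspondence with nonempty compact values. -/
def HCM (S : α → Set E) : Prop :=
  (∀ G, IsClosed G → MeasurableSet {a | (S a ∩ G).Nonempty}) ∧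
    (∀ a, (S a).Nonempty) ∧ ∀ a, IsCompact (S a)

/-- Argmax correspondence. -/
def hargm (S : α → Set E) (J : E → ℝ≥0∞) (a : α) : Set E :=
  {P ∈ S a | ∀ Q ∈ S a, J Q ≤ J P}

lemma exists_max_of_closed {J : E → ℝ≥0∞} (hJ : ∀ c, IsClosed {P | c ≤ J P})
    {K : Set E} (hK : IsCompact K) (hne : K.Nonempty) : ∃ P ∈ K, ∀ Q ∈ K, J Q ≤ J P := by
  have hu : UpperSemicontinuous J := upperSemicontinuous_iff_isClosed_preimage.2 hJ
  obtain ⟨P, hP, hm⟩ := UpperSemicontinuousOn.exists_isMaxOn hne hK (hu.upperSemicontinuousOn K)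
  exact ⟨P, hP, fun Q hQ => hm hQ⟩

lemma hargm_HCM {S : α → Set E} {J : E → ℝ≥0∞} (hJ : ∀ c, IsClosed {P | c ≤ J P})
    (hS : HCM S) : HCM (hargm S J) := by
  obtain ⟨h1, h2, h3⟩ := hS
  refine ⟨fun G hG => ?_, fun a => ?_, fun a => ?_⟩
  · have : {a | (hargm S J a ∩ G).Nonempty} =
        {a | (S a ∩ G).Nonempty} ∩ ⋂ q : ℚ,
          ({a | (S a ∩ {P | ((Real.toNNReal q : ℝ≥0) : ℝ≥0∞) ≤ J P}).Nonempty}ᶜ ∪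
          {a | (S a ∩ (G ∩ {P | ((Real.toNNReal q : ℝ≥0) : ℝ≥0∞) ≤ J P})).Nonempty}) := by
      ext a
      simp only [mem_ofPred_eq, mem_inter_iff, mem_iInter, mem_union, mem_compl_iff]
      constructor
      · rintro ⟨P, ⟨hP, hm⟩, hPG⟩
        refine ⟨⟨P, hP, hPG⟩, fun q => ?_⟩
        by_cases hq : (S a ∩ {P | ((Real.toNNReal q : ℝ≥0) : ℝ≥0∞) ≤ J P}).Nonempty
        · obtain ⟨Q, hQ, hQq⟩ := hq
          exact Or.inr ⟨P, hP, hPG, le_trans hQq (hm Q hQ)⟩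
        · exact Or.inl hq
      · rintro ⟨hn, hq⟩
        obtain ⟨P, hP, hm⟩ := exists_max_of_closed hJ ((h3 a).inter_right hG) hn
        refine ⟨P, ⟨hP.1, fun Q hQ => ?_⟩, hP.2⟩
        by_contra hlt
        obtain ⟨q, -, hq1, hq2⟩ := ENNReal.lt_iff_exists_rat_btwn.1 (not_le.1 hlt)
        rcases hq q with h | ⟨P', hP', hP'G, hP'q⟩
        · exact h ⟨Q, hQ, hq2.le⟩
        · exact absurd (hq1.trans_le (le_trans hP'q (hm P' ⟨hP', hP'G⟩))) (lt_irrefl _)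
    rw [this]
    exact (h1 G hG).inter (MeasurableSet.iInter fun q =>
      (h1 _ (hJ _)).compl.union (h1 _ (hG.inter (hJ _))))
  · exact exists_max_of_closed hJ (h3 a) (h2 a)
  · obtain ⟨P, hP, hm⟩ := exists_max_of_closed hJ (h3 a) (h2 a)
    have : hargm S J a = S a ∩ {Q | J P ≤ J Q} := by
      ext Q
      exact ⟨fun h => ⟨h.1, h.2 P hP⟩, fun h => ⟨h.1, fun R hR => (hm R hR).trans h.2⟩⟩
    rw [this]
    exact (h3 a).inter_right (hJ _)

/-- Iterated argmax. -/
def hiter (S : α → Set E) (J : ℕ → E → ℝ≥0∞) : ℕ → α → Set E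
  | 0 => S
  | n + 1 => hargm (hiter S J n) (J n)

lemma exists_selection [T2Space E] {S : α → Set E} (hS : HCM S) (J : ℕ → E → ℝ≥0∞)
    (hJ : ∀ n c, IsClosed {P | c ≤ J n P})
    (hsep : ∀ P Q, (∀ n, J n P = J n Q) → P = Q) :
    ∃ s : α → E, (∀ a, s a ∈ S a) ∧ ∀ G, IsClosed G → MeasurableSet (s ⁻¹' G) := by
  have hI : ∀ n, HCM (hiter S J n) := by
    intro n
    induction n with
    | zero => exact hS
    | succ n ih => exact hargm_HCM (hJ n) ih
  have key : ∀ a G, IsClosed G → (∀ n, (hiter S J n a ∩ G).Nonempty) →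
      (⋂ n, (hiter S J n a ∩ G)).Nonempty := by
    intro a G hG h
    refine IsCompact.nonempty_iInter_of_sequence_nonempty_isCompact_isClosed _ ?_ h ?_ ?_
    · exact fun n => inter_subset_inter_left _ fun P hP => hP.1
    · exact ((hI 0).2.2 a).inter_right hG
    · exact fun n => ((hI n).2.2 a).isClosed.inter hG
  have hne : ∀ a, ∃ P, ∀ n, P ∈ hiter S J n a := by
    intro a
    obtain ⟨P, hP⟩ := key a univ isClosed_univ (fun n => by simpa using (hI n).2.1 a)
    exact ⟨P, fun n => (mem_iInter.1 hP n).1⟩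
  choose s hs using hne
  have huniq : ∀ a P, (∀ n, P ∈ hiter S J n a) → P = s a := by
    intro a P hP
    refine hsep _ _ fun n => le_antisymm ?_ ?_
    · exact (hs a (n + 1)).2 _ (hP n)
    · exact (hP (n + 1)).2 _ (hs a n)
  refine ⟨s, fun a => hs a 0, fun G hG => ?_⟩
  have : s ⁻¹' G = ⋂ n, {a | (hiter S J n a ∩ G).Nonempty} := by
    ext a
    simp only [mem_preimage, mem_iInter, mem_ofPred_eq]
    refine ⟨fun h n => ⟨s a, hs a n, h⟩, fun h => ?_⟩
    obtain ⟨P, hP⟩ := key a G hG h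
    rw [← huniq a P (fun n => (mem_iInter.1 hP n).1)]
    exact (mem_iInter.1 hP 0).2
  rw [this]
  exact MeasurableSet.iInter fun n => (hI n).1 G hG

variable {W : Type*} [TopologicalSpace W] [PolishSpace W] [MeasurableSpace W] [BorelSpace W]

lemma isClosed_superlevel_measure {C : Set W} (hC : IsClosed C) (c : ℝ≥0∞) :
    IsClosed {P : ProbabilityMeasure W | c ≤ (P : Measure W) C} := by
  refine IsSeqClosed.isClosed fun u P hu hP => ?_
  refine le_trans ?_ (ProbabilityMeasure.limsup_measure_closed_le_of_tendsto hP hC)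
  exact le_limsup_of_frequently_le (Frequently.of_forall hu)

lemma isClosed_superlevel_lintegral {f : W → ℝ} (hf : UpperSemicontinuous f) {B : ℝ}
    (h0 : ∀ x, 0 ≤ f x) (hB : ∀ x, f x ≤ B) (c : ℝ≥0∞) :
    IsClosed {P : ProbabilityMeasure W | c ≤ ∫⁻ x, ENNReal.ofReal (f x) ∂(P : Measure W)} := by
  have hlc : ∀ P : ProbabilityMeasure W, ∫⁻ x, ENNReal.ofReal (f x) ∂(P : Measure W) =
      ∫⁻ t in Ioi 0, (P : Measure W) {a | t ≤ f a} := fun P =>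
    lintegral_eq_lintegral_meas_le _ (Eventually.of_forall h0) hf.measurable.aemeasurable
  refine IsSeqClosed.isClosed fun u P hu hP => ?_
  simp only [mem_ofPred_eq, hlc] at hu ⊢
  calc c ≤ limsup (fun n => ∫⁻ t in Ioi 0, (u n : Measure W) {a | t ≤ f a}) atTop :=
        le_limsup_of_frequently_le (Frequently.of_forall hu)
    _ ≤ ∫⁻ t in Ioi 0, limsup (fun n => (u n : Measure W) {a | t ≤ f a}) atTop := by
        refine limsup_lintegral_le (indicator (Ioc 0 B) 1) ?_ ?_ ?_
        · intro n
          exact Antitone.measurable fun s t hst => measure_mono fun a ha => le_trans hst ha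
        · intro n
          filter_upwards [ae_restrict_mem measurableSet_Ioi] with t ht
          by_cases h : t ≤ B
          · rw [indicator_of_mem (show t ∈ Ioc 0 B from ⟨ht, h⟩)]
            exact prob_le_one
          · have : {a | t ≤ f a} = ∅ := by
              ext a; simp only [mem_ofPred_eq, mem_empty_iff_false, iff_false]
              exact fun h' => h (h'.trans (hB a))
            simp [this]
        · rw [lintegral_indicator_one measurableSet_Ioc]
          refine ne_of_lt (lt_of_le_of_lt (Measure.restrict_apply_le _ _) ?_)
          simp
    _ ≤ _ := by
        refine lintegral_mono fun t => ?_
        exact ProbabilityMeasure.limsup_measure_closed_le_of_tendsto hP (hf.isClosed_preimage t)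

lemma exists_separating : ∃ C : ℕ → Set W, (∀ n, IsClosed (C n)) ∧
    ∀ P Q : ProbabilityMeasure W, (∀ n, (P : Measure W) (C n) = (Q : Measure W) (C n)) →
      P = Q := by
  let b := TopologicalSpace.countableBasis W
  have hb : TopologicalSpace.IsTopologicalBasis b := TopologicalSpace.isBasis_countableBasis W
  have hbc : b.Countable := TopologicalSpace.countable_countableBasis W
  let D : Set (Set W) := (fun f : Set (Set W) => ⋂₀ f) '' {f | f.Finite ∧ f ⊆ b}
  have hDc : D.Countable := (countable_ofPred_finite_subset hbc).image _
  have hDo : ∀ U ∈ D, IsOpen U := by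
    rintro _ ⟨f, ⟨hf, hfb⟩, rfl⟩
    exact hf.isOpen_sInter fun s hs => hb.isOpen (hfb hs)
  have hDne : D.Nonempty := ⟨_, ∅, ⟨finite_empty, empty_subset _⟩, rfl⟩
  obtain ⟨U, hU⟩ := hDc.exists_eq_range hDne
  have hUD : ∀ n, U n ∈ D := fun n => hU ▸ mem_range_self n
  refine ⟨fun n => (U n)ᶜ, fun n => (hDo _ (hUD n)).isClosed_compl, fun P Q h => ?_⟩
  apply Subtype.ext
  change (P : Measure W) = (Q : Measure W)
  refine ext_of_generate_finite D ?_ ?_ ?_ (by simp)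
  · rw [BorelSpace.measurable_eq (α := W), hb.borel_eq_generateFrom]
    refine le_antisymm (MeasurableSpace.generateFrom_mono fun s hs => ?_)
      (MeasurableSpace.generateFrom_le fun s hs => ?_)
    · exact ⟨{s}, ⟨finite_singleton s, by simpa using hs⟩, by simp⟩
    · rw [← hb.borel_eq_generateFrom]
      exact MeasurableSpace.measurableSet_generateFrom (hDo s hs)
  · rintro _ ⟨f, ⟨hf, hfb⟩, rfl⟩ _ ⟨g, ⟨hg, hgb⟩, rfl⟩ -
    exact ⟨f ∪ g, ⟨hf.union hg, union_subset hfb hgb⟩, sInter_union f g⟩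
  · intro s hs
    rw [hU] at hs
    obtain ⟨n, rfl⟩ := hs
    have hm : MeasurableSet (U n) := (hDo _ (hUD n)).measurableSet
    have := h n
    have e1 := prob_compl_eq_one_sub (μ := (P : Measure W)) hm.compl
    have e2 := prob_compl_eq_one_sub (μ := (Q : Measure W)) hm.compl
    rw [compl_compl] at e1 e2
    exact e1.trans ((by rw [this]) : _ = _) |>.trans e2.symm

lemma measurable_of_closed {s : α → ProbabilityMeasure W}
    (hs : ∀ G, IsClosed G → MeasurableSet (s ⁻¹' G)) :
    Measurable fun a => (s a : Measure W) := by
  refine Measurable.measure_of_isPiSystem_of_isProbabilityMeasure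
    (S := {C | IsClosed C}) ?_ isPiSystem_isClosed ?_
  · rw [BorelSpace.measurable_eq (α := W), borel_eq_generateFrom_isClosed]
  · intro C hC
    refine measurable_of_Ici fun c => ?_
    exact hs _ (isClosed_superlevel_measure hC c)

lemma exists_measurable_selection {S : α → Set (ProbabilityMeasure W)} (hS : HCM S) :
    ∃ s : α → ProbabilityMeasure W, (∀ a, s a ∈ S a) ∧
      Measurable fun a => (s a : Measure W) := by
  obtain ⟨C, hC, hsep⟩ := exists_separating (W := W)
  obtain ⟨s, h1, h2⟩ := exists_selection hS (fun n P => (P : Measure W) (C n))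
    (fun n c => isClosed_superlevel_measure (hC n) c) hsep
  exact ⟨s, h1, measurable_of_closed h2⟩

end HelperAbstract
section HelperRCP

open ProbabilityTheory

variable {V W : Type*} [MeasurableSpace V] [MeasurableSpace W]

lemma rcp_abstract (P : Measure W) [IsProbabilityMeasure P] {j : W → V} (hj : Measurable j)
    (K : Kernel V W) [IsMarkovKernel K]
    (hK : ∀ A B, MeasurableSet A → MeasurableSet B →
      P (A ∩ j ⁻¹' B) = ∫⁻ v in B, K v A ∂(P.map j)) :
    (P.map j).compProd K = P.map (fun w => (j w, w)) := by
  have : IsProbabilityMeasure (P.map j) := Measure.isProbabilityMeasure_map hj.aemeasurable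
  refine Measure.ext_prod fun {B A} hB hA => ?_
  rw [Measure.compProd_apply_prod hB hA, Measure.map_apply (by fun_prop) (hB.prod hA),
    ← hK A B hA hB]
  congr 1
  ext w
  simp [and_comm]

lemma rcp_abstract_ae (P : Measure W) [IsProbabilityMeasure P] {j : W → V} (hj : Measurable j)
    (K : Kernel V W) [IsMarkovKernel K]
    (hK : ∀ A B, MeasurableSet A → MeasurableSet B →
      P (A ∩ j ⁻¹' B) = ∫⁻ v in B, K v A ∂(P.map j))
    {p : Set (V × W)} (hp : MeasurableSet p) (h : ∀ w, (j w, w) ∈ p) :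
    ∀ᵐ v ∂(P.map j), ∀ᵐ w ∂(K v), (v, w) ∈ p := by
  have : IsProbabilityMeasure (P.map j) := Measure.isProbabilityMeasure_map hj.aemeasurable
  refine Measure.ae_ae_of_ae_compProd (p := fun x => x ∈ p) ?_
  rw [rcp_abstract P hj K hK]
  exact (ae_map_iff (p := fun x => x ∈ p) (by fun_prop) hp).2 (Eventually.of_forall h)

lemma rcp_abstract_lintegral (P : Measure W) [IsProbabilityMeasure P] {j : W → V}
    (hj : Measurable j) (K : Kernel V W) [IsMarkovKernel K]
    (hK : ∀ A B, MeasurableSet A → MeasurableSet B →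
      P (A ∩ j ⁻¹' B) = ∫⁻ v in B, K v A ∂(P.map j))
    {f : W → ℝ≥0∞} (hf : Measurable f) :
    ∫⁻ v, ∫⁻ w, f w ∂(K v) ∂(P.map j) = ∫⁻ w, f w ∂P := by
  have : IsProbabilityMeasure (P.map j) := Measure.isProbabilityMeasure_map hj.aemeasurable
  rw [← Measure.lintegral_compProd (f := fun x => f x.2) (by fun_prop), rcp_abstract P hj K hK,
    lintegral_map (by fun_prop) (by fun_prop)]

end HelperRCP

section HelperRCP2

open ProbabilityTheory

variable {W : Type*} {m : MeasurableSpace W} [mW : MeasurableSpace W]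

lemma rcp_concrete (hm : m ≤ mW) (P : Measure[mW] W) [IsProbabilityMeasure P]
    (κ : W → Measure[mW] W) (hp : ∀ ω, IsProbabilityMeasure (κ ω))
    (hmeas : ∀ A : Set W, MeasurableSet[mW] A → Measurable[m] fun ω => κ ω A)
    (hP : ∀ A B : Set W, MeasurableSet[mW] A → MeasurableSet[m] B →
      P (A ∩ B) = ∫⁻ ω in B, κ ω A ∂P) :
    (∀ f : W → ℝ≥0∞, Measurable[mW] f →
      (Measurable[m] fun ω => ∫⁻ w, f w ∂(κ ω)) ∧
      ∫⁻ ω, ∫⁻ w, f w ∂(κ ω) ∂P = ∫⁻ w, f w ∂P) ∧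
    (∀ p : Set (W × W), MeasurableSet[m.prod mW] p → (∀ w, (w, w) ∈ p) →
      ∀ᵐ ω ∂(P.trim hm), ∀ᵐ w ∂(κ ω), (ω, w) ∈ p) := by
  let K : @Kernel W W m mW :=
    @Kernel.mk W W m mW κ (@Measure.measurable_of_measurable_coe W W mW m κ hmeas)
  have hKm : @IsMarkovKernel W W m mW K := @IsMarkovKernel.mk W W m mW K hp
  have hid : @Measurable W W mW m id := measurable_id'' hm
  have hK : ∀ A B, MeasurableSet[mW] A → MeasurableSet[m] B →
      P (A ∩ id ⁻¹' B) = @lintegral W m ((@Measure.map W W mW m id P).restrict B)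
        (fun v => K v A) := by
    intro A B hA hB
    have := hP A B hA hB
    rw [preimage_id, this, ← trim_eq_map hm, restrict_trim hm P hB]
    exact (lintegral_trim hm (hmeas A hA)).symm
  refine ⟨fun f hf => ?_, fun p hp' h => ?_⟩
  · have h1 : Measurable[m] fun ω => ∫⁻ w, f w ∂(κ ω) :=
      @Measurable.lintegral_kernel W W m mW K f hf
    refine ⟨h1, ?_⟩
    have := @rcp_abstract_lintegral W W m mW P _ id hid K hKm hK f hf
    rw [← this, ← trim_eq_map hm, lintegral_trim hm]
    · rfl
    · exact h1
  · have := @rcp_abstract_ae W W m mW P _ id hid K hKm hK p hp' h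
    rw [← trim_eq_map hm] at this
    exact this

lemma exists_rcp [StandardBorelSpace W] (hm : m ≤ mW) (P : Measure[mW] W)
    [IsProbabilityMeasure P] : ∃ κ : W → Measure[mW] W,
    (∀ ω, IsProbabilityMeasure (κ ω)) ∧
    (∀ A : Set W, MeasurableSet[mW] A → Measurable[m] fun ω => κ ω A) ∧
    (∀ A B : Set W, MeasurableSet[mW] A → MeasurableSet[m] B →
      P (A ∩ B) = ∫⁻ ω in B, κ ω A ∂P) := by
  refine ⟨fun ω => condExpKernel P m ω, fun ω => inferInstance,
    fun A hA => measurable_condExpKernel hA, fun A B hA hB => ?_⟩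
  have h := compProd_trim_condExpKernel (μ := P) hm
  have h2 := congrArg (fun μ => μ (B ×ˢ A)) h
  rw [@Measure.compProd_apply_prod W W m mW _ _ _ _ B A hB hA, Measure.map_apply] at h2
  · rw [restrict_trim hm P hB, lintegral_trim hm (measurable_condExpKernel hA)] at h2
    rw [h2]
    congr 1
    ext w
    simp [and_comm]
  · exact Measurable.prodMk (measurable_id'' hm) measurable_id
  · exact @MeasurableSet.prod W W m mW B A hB hA

end HelperRCP2
section HelperPath

lemma polish_path : PolishSpace C(ℝ≥0, F) := by
  let := TopologicalSpace.upgradeIsCompletelyMetrizable F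
  have : (uniformity C(ℝ≥0, F)).IsCountablyGenerated := inferInstance
  have : CompleteSpace C(ℝ≥0, F) := inferInstance
  have : T0Space C(ℝ≥0, F) := inferInstance
  have : TopologicalSpace.SeparableSpace C(ℝ≥0, F) := inferInstance
  infer_instance

lemma measurable_eval (s : ℝ≥0) : Measurable (fun ω : C(ℝ≥0, F) => ω s) :=
  (continuous_eval_const s).measurable

lemma canonicalSig_le (t : ℝ≥0) : canonicalSig F t ≤ (inferInstance : MeasurableSpace C(ℝ≥0, F)) := by
  refine iSup₂_le fun s _ => ?_
  rw [← BorelSpace.measurable_eq (α := F)]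
  exact (measurable_eval s).comap_le

lemma canonicalSig_mono {s t : ℝ≥0} (h : s ≤ t) : canonicalSig F s ≤ canonicalSig F t :=
  biSup_mono fun _ hr => le_trans hr h

lemma measurable_eval_can {s t : ℝ≥0} (h : s ≤ t) :
    Measurable[canonicalSig F t] (fun ω : C(ℝ≥0, F) => ω s) := by
  rw [measurable_iff_comap_le]
  rw [BorelSpace.measurable_eq (α := F)]
  exact le_iSup₂_of_le (f := fun s (_ : s ∈ Set.Iic t) =>
    MeasurableSpace.comap (fun ω : C(ℝ≥0, F) => ω s) (borel F)) s h le_rfl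

lemma measurable_uncurry_eval {V : Type*} {mV : MeasurableSpace V} {g : V → C(ℝ≥0, F)}
    (hg : ∀ s, Measurable fun v => g v s) {σ : V → ℝ≥0} (hσ : Measurable σ) :
    Measurable fun v => g v (σ v) := by
  have := measurable_uncurry_of_continuous_of_measurable (u := fun s v => g v s)
    (fun v => (g v).continuous) hg
  exact this.comp (hσ.prodMk measurable_id)


lemma measurable_min_tau {τ : C(ℝ≥0, F) → ℝ≥0} (hτ : IsStoppingTimeOn (canonicalSig F) τ)
    (t : ℝ≥0) : Measurable[canonicalSig F t] fun ω => min (τ ω) t := by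
  refine @measurable_of_Iic ℝ≥0 C(ℝ≥0, F) _ _ _ (canonicalSig F t) _ _ _ _ fun s => ?_
  by_cases h : t ≤ s
  · have : (fun ω => min (τ ω) t) ⁻¹' Iic s = univ := by
      ext ω; simp [h]
    rw [this]; exact @MeasurableSet.univ _ (canonicalSig F t)
  · have : (fun ω => min (τ ω) t) ⁻¹' Iic s = {ω | τ ω ≤ s} := by
      ext ω; simp [h]
    rw [this]; exact canonicalSig_mono (not_le.1 h).le _ (hτ s)

lemma measurableSet_tau_le {τ : C(ℝ≥0, F) → ℝ≥0} (hτ : IsStoppingTimeOn (canonicalSig F) τ)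
    (t : ℝ≥0) : MeasurableSet {ω | τ ω ≤ t} :=
  canonicalSig_le t _ (hτ t)

lemma ftau_le (τ : C(ℝ≥0, F) → ℝ≥0) :
    ftau τ ≤ (inferInstance : MeasurableSpace C(ℝ≥0, F)) :=
  MeasurableSpace.generateFrom_le fun _ h => h.1

lemma measurable_ftau_of {τ : C(ℝ≥0, F) → ℝ≥0} (hτ : IsStoppingTimeOn (canonicalSig F) τ)
    {Y : Type*} [MeasurableSpace Y] {g : C(ℝ≥0, F) → Y}
    (h : ∀ t, ∃ g' : C(ℝ≥0, F) → Y, Measurable[canonicalSig F t] g' ∧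
      ∀ ω, τ ω ≤ t → g ω = g' ω) : Measurable[ftau τ] g := by
  have h1 : ∀ B, MeasurableSet B → ∀ t,
      MeasurableSet[canonicalSig F t] (g ⁻¹' B ∩ {ω | τ ω ≤ t}) := by
    intro B hB t
    obtain ⟨g', hg', he⟩ := h t
    have : g ⁻¹' B ∩ {ω | τ ω ≤ t} = g' ⁻¹' B ∩ {ω | τ ω ≤ t} := by
      ext ω
      simp only [mem_inter_iff, mem_preimage, mem_ofPred_eq]
      constructor
      · rintro ⟨a, b⟩; exact ⟨he ω b ▸ a, b⟩
      · rintro ⟨a, b⟩; exact ⟨(he ω b).symm ▸ a, b⟩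
    rw [this]
    exact @MeasurableSet.inter _ (canonicalSig F t) _ _ (hg' hB) (hτ t)
  intro B hB
  refine MeasurableSpace.measurableSet_generateFrom ⟨?_, h1 B hB⟩
  have : g ⁻¹' B = ⋃ n : ℕ, (g ⁻¹' B ∩ {ω | τ ω ≤ (n : ℝ≥0)}) := by
    ext ω
    simp only [mem_iUnion, mem_inter_iff, mem_ofPred_eq]
    obtain ⟨n, hn⟩ := exists_nat_ge (τ ω)
    exact ⟨fun a => ⟨n, a, hn⟩, fun ⟨_, a, _⟩ => a⟩
  rw [this]
  exact MeasurableSet.iUnion fun n => canonicalSig_le _ _ (h1 B hB n)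

lemma measurable_ftau_tau {τ : C(ℝ≥0, F) → ℝ≥0} (hτ : IsStoppingTimeOn (canonicalSig F) τ)
    : Measurable[ftau τ] τ :=
  measurable_ftau_of hτ fun t => ⟨_, measurable_min_tau hτ t, fun ω h => (min_eq_left h).symm⟩

lemma measurable_ftau_stopped {τ : C(ℝ≥0, F) → ℝ≥0} (hτ : IsStoppingTimeOn (canonicalSig F) τ)
    : Measurable[ftau τ] fun ω => ω (τ ω) := by
  refine measurable_ftau_of hτ fun t => ⟨fun ω => ω (min (τ ω) t), ?_, fun ω h => by
    simp only [min_eq_left h]⟩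
  have := measurable_uncurry_eval (mV := canonicalSig F t) (V := C(ℝ≥0, F))
    (g := fun ω => ω.comp ⟨fun s => min s t, by fun_prop⟩)
    (fun s => measurable_eval_can (min_le_right s t)) (measurable_min_tau hτ t)
  simpa using this

lemma measurable_ftau_stopped_min {τ : C(ℝ≥0, F) → ℝ≥0} (hτ : IsStoppingTimeOn (canonicalSig F) τ)
    (T : ℝ≥0) :
    Measurable[ftau τ] fun ω => ω (min T (τ ω)) := by
  refine measurable_ftau_of hτ fun t => ⟨fun ω => ω (min T (min (τ ω) t)), ?_, fun ω h => by
    simp only [min_eq_left h]⟩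
  have := measurable_uncurry_eval (mV := canonicalSig F t) (V := C(ℝ≥0, F))
    (g := fun ω => ω.comp ⟨fun s => min T (min s t), by fun_prop⟩)
    (fun s => measurable_eval_can ((min_le_right _ _).trans (min_le_right s t)))
    (measurable_min_tau hτ t)
  simpa using this

lemma concat_apply_le {t T : ℝ≥0} (h : T ≤ t) (ω ω' : C(ℝ≥0, F)) :
    concat t ω ω' T = ω T := by
  unfold concat
  split_ifs with h1
  · simp [h]
  · simp [h]

lemma concat_apply_lt {t T : ℝ≥0} (h : t < T) (ω ω' : C(ℝ≥0, F)) :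
    concat t ω ω' T = concat t (ContinuousMap.const ℝ≥0 (ω t)) ω' T := by
  unfold concat
  by_cases h1 : ω' t = ω t
  · simp [h1, not_le.2 h]
  · simp [h1, h.le]

lemma concat_const_lt {t T : ℝ≥0} (h : t < T) {y : F} {ω' : C(ℝ≥0, F)} (hy : ω' t = y) :
    concat t (ContinuousMap.const ℝ≥0 y) ω' T = ω' T := by
  unfold concat
  simp [hy, not_le.2 h]

lemma concat_const_self {t : ℝ≥0} {y : F} {ω' : C(ℝ≥0, F)} (hy : ∀ s ≤ t, ω' s = y) :
    concat t (ContinuousMap.const ℝ≥0 y) ω' = ω' := by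
  ext s
  unfold concat
  rw [dif_pos (by simpa using hy t le_rfl)]
  by_cases h : s ≤ t
  · simp [h, hy s h]
  · simp [h]

lemma measurable_concat (t : ℝ≥0) (ω : C(ℝ≥0, F)) : Measurable (concat t ω) := by
  have := polish_path (F := F)
  have hK : MeasurableSet {ω' : C(ℝ≥0, F) | ω' t = ω t} :=
    (isClosed_eq (continuous_eval_const t) continuous_const).measurableSet
  refine measurable_of_restrict_of_restrict_compl hK ?_ ?_
  · refine Continuous.measurable ?_
    refine ContinuousMap.continuous_of_continuous_uncurry _ ?_
    have : (Function.uncurry fun (x : {ω' : C(ℝ≥0, F) | ω' t = ω t}) y =>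
        ({ω' : C(ℝ≥0, F) | ω' t = ω t}.domRestrict (concat t ω) x) y) =
        fun p => if p.2 ≤ t then ω p.2 else p.1.1 p.2 := by
      funext p
      obtain ⟨⟨ω', h⟩, s⟩ := p
      have h' : ω' t = ω t := h
      change concat t ω ω' s = _
      simp [concat, h']
    rw [this]
    refine Continuous.if_le (by fun_prop) ?_ continuous_snd continuous_const ?_
    · exact (continuous_subtype_val.comp continuous_fst).eval continuous_snd
    · rintro ⟨⟨ω', h⟩, s⟩ hs
      have h' : ω' t = ω t := h
      simp only at hs
      simp [hs, h']
  · have : {ω' : C(ℝ≥0, F) | ω' t = ω t}ᶜ.domRestrict (concat t ω) =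
        fun _ => ω.comp ⟨fun s => min s t, by fun_prop⟩ := by
      funext ⟨ω', h⟩
      have h' : ¬ ω' t = ω t := h
      change concat t ω ω' = _
      simp [concat, h']
    rw [this]
    exact measurable_const

lemma pastDirac_self {t : ℝ≥0} {y : F} {Q : ProbabilityMeasure C(ℝ≥0, F)}
    (h : (Q : Measure C(ℝ≥0, F)) {ω | ∀ s ≤ t, ω s = y} = 1) :
    pastDirac t y (Q : Measure C(ℝ≥0, F)) = Q := by
  have hae : ∀ᵐ ω ∂(Q : Measure C(ℝ≥0, F)), ∀ s ≤ t, ω s = y := by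
    have hcl : IsClosed {ω : C(ℝ≥0, F) | ∀ s ≤ t, ω s = y} := by
      have : {ω : C(ℝ≥0, F) | ∀ s ≤ t, ω s = y} = ⋂ s ∈ Iic t, {ω | ω s = y} := by
        ext; simp
      rw [this]
      exact isClosed_biInter fun s _ =>
        isClosed_eq (continuous_eval_const s) continuous_const
    exact (prob_compl_eq_zero_iff hcl.measurableSet).2 h
  unfold pastDirac
  rw [Measure.map_congr (g := id), Measure.map_id]
  filter_upwards [hae] with ω hω
  exact concat_const_self hω

lemma lintegral_pastDirac {ψ : F → ℝ≥0∞} (hψ : Measurable ψ) (T t : ℝ≥0) (y : F)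
    (Q : Measure C(ℝ≥0, F)) :
    ∫⁻ ω, ψ (ω T) ∂(pastDirac t y Q) =
      ∫⁻ ω', ψ (concat t (ContinuousMap.const ℝ≥0 y) ω' T) ∂Q :=
  lintegral_map (hψ.comp (measurable_eval T)) (measurable_concat _ _)

lemma lintegral_pasting {ψ : F → ℝ≥0∞} (hψ : Measurable ψ) (T : ℝ≥0)
    (P : Measure C(ℝ≥0, F)) (τ : C(ℝ≥0, F) → ℝ≥0) (Q : C(ℝ≥0, F) → ProbabilityMeasure C(ℝ≥0, F))
    (R : ProbabilityMeasure C(ℝ≥0, F))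
    (hR : (R : Measure C(ℝ≥0, F)) = pasting P τ fun ω => (Q ω : Measure C(ℝ≥0, F))) :
    ∫⁻ ω, ψ (ω T) ∂(R : Measure C(ℝ≥0, F)) = ∫⁻ ω, (if T ≤ τ ω then ψ (ω (min T (τ ω))) else
      ∫⁻ ω', ψ (ω' T) ∂(pastDirac (τ ω) (ω (τ ω)) (Q ω : Measure C(ℝ≥0, F)))) ∂P := by
  have hae : AEMeasurable (fun ω => (Q ω : Measure C(ℝ≥0, F)).map
      fun ω' => concat (τ ω) ω ω') P := by
    by_contra hcon
    have h0 : (R : Measure C(ℝ≥0, F)) = 0 := by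
      rw [hR, pasting, Measure.bind, Measure.map_of_not_aemeasurable hcon, Measure.join_zero]
    exact IsProbabilityMeasure.ne_zero (R : Measure C(ℝ≥0, F)) h0
  have hm : Measurable fun ω : C(ℝ≥0, F) => ψ (ω T) := hψ.comp (measurable_eval T)
  rw [hR, pasting, Measure.lintegral_bind hae hm.aemeasurable]
  refine lintegral_congr fun ω => ?_
  rw [lintegral_map hm (measurable_concat _ _)]
  split_ifs with h
  · simp_rw [concat_apply_le h, min_eq_left h]
    simp
  · rw [lintegral_pastDirac hψ]
    simp_rw [concat_apply_lt (not_le.1 h) ω]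

lemma rcp_path {τ : C(ℝ≥0, F) → ℝ≥0} (hτ : IsStoppingTimeOn (canonicalSig F) τ)
    {P : Measure C(ℝ≥0, F)} [IsProbabilityMeasure P]
    {κ : C(ℝ≥0, F) → Measure C(ℝ≥0, F)} (hκ : IsRCP P τ κ)
    {ψ : F → ℝ≥0∞} (hψ : Measurable ψ) (T : ℝ≥0) :
    Measurable[ftau τ] (fun ω => ∫⁻ ω', ψ (ω' T) ∂(κ ω)) ∧
    ∫⁻ ω, ∫⁻ ω', ψ (ω' T) ∂(κ ω) ∂P = ∫⁻ ω, ψ (ω T) ∂P ∧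
    ∀ᵐ ω ∂(P.trim (ftau_le τ)), ∫⁻ ω', ψ (ω' T) ∂(κ ω) =
      if T ≤ τ ω then ψ (ω (min T (τ ω))) else
      ∫⁻ ω', ψ (ω' T) ∂(pastDirac (τ ω) (ω (τ ω)) (κ ω)) := by
  obtain ⟨hp, hmeas, hP⟩ := hκ
  obtain ⟨h1, h2⟩ := rcp_concrete (ftau_le τ) P κ hp hmeas hP
  have h3 := h1 _ (hψ.comp (measurable_eval T))
  refine ⟨h3.1, h3.2, ?_⟩
  have hset : ∀ σ : C(ℝ≥0, F) → ℝ≥0, Measurable[ftau τ] σ →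
      (Measurable[ftau τ] fun ω => ω (σ ω)) →
      MeasurableSet[(ftau τ).prod inferInstance]
        {p : C(ℝ≥0, F) × C(ℝ≥0, F) | p.2 (σ p.1) = p.1 (σ p.1)} := by
    intro σ hσ hX
    have a1 := measurable_uncurry_eval (V := C(ℝ≥0, F) × C(ℝ≥0, F))
      (mV := (ftau τ).prod inferInstance) (g := fun p => p.2)
      (fun s => (measurable_eval s).comp (@measurable_snd _ _ (ftau τ) _)) (σ := fun p => σ p.1)
      (hσ.comp (@measurable_fst _ _ (ftau τ) _))
    have a2 := hX.comp (@measurable_fst _ C(ℝ≥0, F) (ftau τ) inferInstance)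
    exact measurableSet_eq_fun a1 a2
  have b1 := h2 _ (hset τ (measurable_ftau_tau hτ) (measurable_ftau_stopped hτ)) (fun w => rfl)
  have b2 := h2 _ (hset (fun ω => min T (τ ω))
    ((@measurable_const _ _ _ (ftau τ) T).min (measurable_ftau_tau hτ))
    (measurable_ftau_stopped_min hτ T)) (fun w => rfl)
  filter_upwards [b1, b2] with ω c1 c2
  have := hp ω
  split_ifs with h
  · have : ∀ᵐ ω' ∂(κ ω), ψ (ω' T) = ψ (ω (min T (τ ω))) := by
      filter_upwards [c2] with ω' d
      have d' : ω' (min T (τ ω)) = ω (min T (τ ω)) := d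
      rw [← d', min_eq_left h]
    rw [lintegral_congr_ae this]
    simp
  · rw [lintegral_pastDirac hψ]
    refine lintegral_congr_ae ?_
    filter_upwards [c1] with ω' d
    rw [concat_const_lt (not_le.1 h) d]

end HelperPath
section HelperMain

/-- The value functional. -/
def Jl (ψ : F → ℝ≥0∞) (T : ℝ≥0) (P : ProbabilityMeasure C(ℝ≥0, F)) : ℝ≥0∞ :=
  ∫⁻ ω, ψ (ω T) ∂(P : Measure C(ℝ≥0, F))

/-- Optimizers of the value functional. -/
def Uopt (𝒰 : ℝ≥0 → F → Set (ProbabilityMeasure C(ℝ≥0, F))) (ψ : F → ℝ≥0∞) (T : ℝ≥0)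
    (t : ℝ≥0) (x : F) : Set (ProbabilityMeasure C(ℝ≥0, F)) :=
  {P ∈ 𝒰 t x | ∀ Q ∈ 𝒰 t x, Jl ψ T Q ≤ Jl ψ T P}

lemma Jl_of_le {t T : ℝ≥0} (h : T ≤ t) (ψ : F → ℝ≥0∞) {y : F} {P : ProbabilityMeasure C(ℝ≥0, F)}
    (hP : (P : Measure C(ℝ≥0, F)) {ω | ∀ s ≤ t, ω s = y} = 1) : Jl ψ T P = ψ y := by
  have hae : ∀ᵐ ω ∂(P : Measure C(ℝ≥0, F)), ω T = y := by
    have hcl : IsClosed {ω : C(ℝ≥0, F) | ω T = y} :=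
      isClosed_eq (continuous_eval_const T) continuous_const
    refine (prob_compl_eq_zero_iff hcl.measurableSet).2 ?_
    refine le_antisymm prob_le_one ?_
    rw [← hP]
    exact measure_mono fun ω hω => hω T h
  have : ∀ᵐ ω ∂(P : Measure C(ℝ≥0, F)), ψ (ω T) = ψ y := by
    filter_upwards [hae] with ω hω
    rw [hω]
  unfold Jl
  rw [lintegral_congr_ae this]
  simp

lemma Uopt_paste {𝒰 : ℝ≥0 → F → Set (ProbabilityMeasure C(ℝ≥0, F))}
    (hcond : StableCond 𝒰) (hpaste : StablePaste 𝒰)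
    {ψ : F → ℝ≥0∞} (hψ : Measurable ψ) (T : ℝ≥0) : StablePaste (Uopt 𝒰 ψ T) := by
  intro t x P hP τ hτ htτ Q hQm hQ
  have := polish_path (F := F)
  obtain ⟨R, hR, hRe⟩ := hpaste t x P hP.1 τ hτ htτ Q hQm (by
    filter_upwards [hQ] with ω ⟨R, hR, he⟩
    exact ⟨R, hR.1, he⟩)
  refine ⟨R, ⟨hR, fun Q' hQ' => (hP.2 Q' hQ').trans ?_⟩, hRe⟩
  obtain ⟨κ, hκ⟩ := exists_rcp (ftau_le τ) (P : Measure C(ℝ≥0, F))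
  have hκ' : IsRCP (P : Measure C(ℝ≥0, F)) τ κ := hκ
  obtain ⟨N, _, hN0, hN⟩ := hcond t x P hP.1 τ hτ htτ κ hκ'
  obtain ⟨_, h2, h3⟩ := rcp_path hτ hκ' hψ T
  unfold Jl
  rw [lintegral_pasting hψ T _ τ Q R hRe, ← h2]
  refine lintegral_mono_ae ?_
  have hN' : ∀ᵐ ω ∂(P : Measure C(ℝ≥0, F)), ω ∉ N := measure_eq_zero_iff_ae_notMem.1 hN0
  filter_upwards [ae_of_ae_trim _ h3, hQ, hN'] with ω e1 ⟨R1, hR1, e2⟩ e3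
  rw [e1]
  split_ifs with h
  · exact le_rfl
  · obtain ⟨R2, hR2, e4⟩ := hN ω e3
    rw [← e4, ← e2]
    exact hR1.2 R2 hR2

lemma Uopt_cond {𝒰 : ℝ≥0 → F → Set (ProbabilityMeasure C(ℝ≥0, F))}
    (hcond : StableCond 𝒰) (hpaste : StablePaste 𝒰)
    (hsupp : ∀ (t : ℝ≥0) (x : F), ∀ P ∈ 𝒰 t x,
      (P : Measure C(ℝ≥0, F)) {ω | ∀ s ≤ t, ω s = x} = 1)
    {ψ : F → ℝ≥0∞} (hψ : Measurable ψ) (T : ℝ≥0)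
    (hfin : ∀ P, Jl ψ T P ≠ ∞)
    (hS : HCM fun p : ℝ≥0 × F => Uopt 𝒰 ψ T p.1 p.2) : StableCond (Uopt 𝒰 ψ T) := by
  intro t x P hP τ hτ htτ κ hκ
  have := polish_path (F := F)
  obtain ⟨s, hs, hsm⟩ := exists_measurable_selection hS
  have hpair : Measurable[ftau τ] fun ω => (τ ω, ω (τ ω)) :=
    (measurable_ftau_tau hτ).prodMk (measurable_ftau_stopped hτ)
  set Q : C(ℝ≥0, F) → ProbabilityMeasure C(ℝ≥0, F) := fun ω => s (τ ω, ω (τ ω)) with hQdef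
  have hQs : ∀ ω, Q ω ∈ Uopt 𝒰 ψ T (τ ω) (ω (τ ω)) := fun ω => hs (τ ω, ω (τ ω))
  have hQm : Measurable[ftau τ] fun ω => (Q ω : Measure C(ℝ≥0, F)) := hsm.comp hpair
  have hpd : ∀ ω, pastDirac (τ ω) (ω (τ ω)) (Q ω : Measure C(ℝ≥0, F)) = Q ω := fun ω =>
    pastDirac_self (hsupp _ _ _ (hQs ω).1)
  obtain ⟨R, hR, hRe⟩ := hpaste t x P hP.1 τ hτ htτ Q
    (fun A hA => (Measure.measurable_coe hA).comp hQm)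
    (Eventually.of_forall fun ω => ⟨Q ω, (hQs ω).1, (hpd ω).symm⟩)
  have hRP : Jl ψ T R ≤ Jl ψ T P := hP.2 R hR
  obtain ⟨N, hNm, hN0, hN⟩ := hcond t x P hP.1 τ hτ htτ κ hκ
  obtain ⟨h1, h2, h3⟩ := rcp_path hτ hκ hψ T
  have hm : Measurable fun ω : C(ℝ≥0, F) => ψ (ω T) := hψ.comp (measurable_eval T)
  set g2 : C(ℝ≥0, F) → ℝ≥0∞ := fun ω => if T ≤ τ ω then ψ (ω (min T (τ ω))) else
      ∫⁻ ω', ψ (ω' T) ∂(Q ω : Measure C(ℝ≥0, F)) with hg2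
  have hg2m : Measurable[ftau τ] g2 := by
    refine Measurable.ite ?_ ?_ ?_
    · exact (measurable_ftau_tau hτ) measurableSet_Ici
    · exact hψ.comp (measurable_ftau_stopped_min hτ T)
    · exact (Measure.measurable_lintegral hm).comp hQm
  have hRg : Jl ψ T R = ∫⁻ ω, g2 ω ∂(P : Measure C(ℝ≥0, F)) := by
    unfold Jl
    rw [lintegral_pasting hψ T _ τ Q R hRe]
    simp_rw [hpd]
    rfl
  have hN' : ∀ᵐ ω ∂((P : Measure C(ℝ≥0, F)).trim (ftau_le τ)), ω ∉ N := by
    refine measure_eq_zero_iff_ae_notMem.1 ?_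
    rw [trim_measurableSet_eq _ hNm, hN0]
  have hle : (fun ω => ∫⁻ ω', ψ (ω' T) ∂(κ ω))
      ≤ᵐ[(P : Measure C(ℝ≥0, F)).trim (ftau_le τ)] g2 := by
    filter_upwards [h3, hN'] with ω e1 e2
    rw [e1, hg2]
    dsimp only
    split_ifs with h
    · exact le_rfl
    · obtain ⟨R2, hR2, e4⟩ := hN ω e2
      rw [← e4]
      exact (hQs ω).2 R2 hR2
  have heq := ae_eq_of_ae_le_of_lintegral_le hle
    (by rw [lintegral_trim _ h1, h2]; exact hfin P)
    (@Measurable.aemeasurable _ _ (ftau τ) _ _ _ hg2m)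
    (by rw [lintegral_trim _ h1, lintegral_trim _ hg2m, h2, ← hRg]; exact hRP)
  have hall : ∀ᵐ ω ∂((P : Measure C(ℝ≥0, F)).trim (ftau_le τ)), ω ∉ N ∧
      g2 ω = if T ≤ τ ω then ψ (ω (min T (τ ω))) else
      ∫⁻ ω', ψ (ω' T) ∂(pastDirac (τ ω) (ω (τ ω)) (κ ω)) := by
    filter_upwards [h3, hN', heq] with ω e1 e2 e3
    exact ⟨e2, by rw [← e3]; exact e1⟩
  obtain ⟨N1, hsub, hN1m, hN10⟩ := @exists_measurable_superset_of_null _ (ftau τ) _ _ (ae_iff.1 hall)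
  refine ⟨N1, hN1m, ?_, fun ω hω => ?_⟩
  · rw [← trim_measurableSet_eq (ftau_le τ) hN1m]; exact hN10
  · have hω' := not_not.1 fun hc => hω (hsub hc)
    obtain ⟨R2, hR2, e4⟩ := hN ω hω'.1
    refine ⟨R2, ⟨hR2, fun Q' hQ' => ?_⟩, e4⟩
    by_cases h : T ≤ τ ω
    · rw [Jl_of_le h ψ (hsupp _ _ _ hQ'), Jl_of_le h ψ (hsupp _ _ _ hR2)]
    · have e := hω'.2
      simp only [hg2, if_neg h] at e
      rw [← e4] at e
      exact ((hQs ω).2 Q' hQ').trans e.le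

lemma Uopt_convex {𝒰 : ℝ≥0 → F → Set (ProbabilityMeasure C(ℝ≥0, F))}
    {ψ : F → ℝ≥0∞} (T : ℝ≥0) (hc : ConvexVals 𝒰) : ConvexVals (Uopt 𝒰 ψ T) := by
  intro t x P hP Q hQ α hα
  obtain ⟨R, hR, hRe⟩ := hc t x P hP.1 Q hQ.1 α hα
  refine ⟨R, ⟨hR, fun Q' hQ' => (hP.2 Q' hQ').trans ?_⟩, hRe⟩
  have hPQ : Jl ψ T Q = Jl ψ T P := le_antisymm (hP.2 Q hQ.1) (hQ.2 P hP.1)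
  have : Jl ψ T R = ENNReal.ofReal α * Jl ψ T P + ENNReal.ofReal (1 - α) * Jl ψ T Q := by
    unfold Jl
    rw [hRe, lintegral_add_measure, lintegral_smul_measure, lintegral_smul_measure]
    rfl
  rw [this, hPQ, ← add_mul, ← ENNReal.ofReal_add hα.1.le (by linarith [hα.2])]
  simp

lemma Ustar_eq {𝒰 : ℝ≥0 → F → Set (ProbabilityMeasure C(ℝ≥0, F))}
    {φ : F → ℝ} {M : ℝ} (hM : ∀ y, |φ y| ≤ M) (hφ : Measurable φ) (T : ℝ≥0) :
    (∀ P, Jl (fun y => ENNReal.ofReal (φ y + M)) T P ≠ ∞) ∧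
    Ustar 𝒰 φ T = Uopt 𝒰 (fun y => ENNReal.ofReal (φ y + M)) T := by
  have hfin : ∀ P, Jl (fun y => ENNReal.ofReal (φ y + M)) T P ≠ ∞ := by
    intro P
    refine ne_top_of_le_ne_top (b := ENNReal.ofReal (M + M)) ENNReal.ofReal_ne_top ?_
    unfold Jl
    calc _ ≤ ∫⁻ _, ENNReal.ofReal (M + M) ∂(P : Measure C(ℝ≥0, F)) :=
          lintegral_mono fun ω => ENNReal.ofReal_le_ofReal (by
            linarith [(abs_le.1 (hM (ω T))).2])
      _ = _ := by simp
  refine ⟨hfin, ?_⟩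
  have hφm : Measurable fun ω : C(ℝ≥0, F) => φ (ω T) := hφ.comp (measurable_eval T)
  have key : ∀ P : ProbabilityMeasure C(ℝ≥0, F), ∫ ω, φ (ω T) ∂(P : Measure C(ℝ≥0, F)) =
      (Jl (fun y => ENNReal.ofReal (φ y + M)) T P).toReal - M := by
    intro P
    have hint : Integrable (fun ω : C(ℝ≥0, F) => φ (ω T)) (P : Measure C(ℝ≥0, F)) :=
      Integrable.of_bound hφm.aestronglyMeasurable M (Eventually.of_forall fun ω => hM _)
    have h1 : ∫ ω, (φ (ω T) + M) ∂(P : Measure C(ℝ≥0, F)) =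
        ∫ ω, φ (ω T) ∂(P : Measure C(ℝ≥0, F)) + M := by
      rw [integral_add hint (integrable_const _)]
      simp
    have h2 := integral_eq_lintegral_of_nonneg_ae (μ := (P : Measure C(ℝ≥0, F)))
      (f := fun ω => φ (ω T) + M)
      (Eventually.of_forall fun ω => by
        have := (abs_le.1 (hM (ω T))).1
        simp only [Pi.zero_apply]
        linarith)
      (hφm.add_const M).aestronglyMeasurable
    unfold Jl
    rw [← h2, h1]
    ring
  have hbdd : ∀ t x, BddAbove ((fun Q : ProbabilityMeasure C(ℝ≥0, F) =>
      ∫ ω, φ (ω T) ∂(Q : Measure C(ℝ≥0, F))) '' 𝒰 t x) := by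
    intro t x
    refine ⟨M, ?_⟩
    rintro _ ⟨Q, -, rfl⟩
    have := norm_integral_le_of_norm_le_const (μ := (Q : Measure C(ℝ≥0, F)))
      (f := fun ω => φ (ω T)) (C := M) (Eventually.of_forall fun ω => hM _)
    simp only [probReal_univ, mul_one] at this
    exact (le_abs_self _).trans this
  funext t x
  ext P
  constructor
  · rintro ⟨hP, he⟩
    refine ⟨hP, fun Q hQ => ?_⟩
    have := le_csSup (hbdd t x) (mem_image_of_mem _ hQ)
    rw [← he] at this
    simp only [key] at this
    rw [← ENNReal.toReal_le_toReal (hfin Q) (hfin P)]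
    linarith
  · rintro ⟨hP, he⟩
    refine ⟨hP, ?_⟩
    symm
    apply IsGreatest.csSup_eq
    refine ⟨⟨P, hP, rfl⟩, ?_⟩
    rintro _ ⟨Q, hQ, rfl⟩
    have := (ENNReal.toReal_le_toReal (hfin Q) (hfin P)).2 (he Q hQ)
    simp only [key]
    linarith

end HelperMain

/-- **Preservation of stability under optimization**. -/
theorem preservation_of_stability_under_optimization
    (𝒰 : ℝ≥0 → F → Set (ProbabilityMeasure C(ℝ≥0, F)))
    (hmeas : MeasCorr 𝒰)
    (hne : ∀ t x, (𝒰 t x).Nonempty)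
    (hcpt : ∀ t x, IsCompact (𝒰 t x))
    (hsupp : ∀ (t : ℝ≥0) (x : F), ∀ P ∈ 𝒰 t x,
      (P : Measure C(ℝ≥0, F)) {ω | ∀ s ≤ t, ω s = x} = 1)
    (hcond : StableCond 𝒰) (hpaste : StablePaste 𝒰)
    (φ : F → ℝ) (hb : ∃ M : ℝ, ∀ y, |φ y| ≤ M) (husc : UpperSemicontinuous φ)
    (T : ℝ≥0) (hT : 0 < T) :
    MeasCorr (Ustar 𝒰 φ T) ∧ (∀ t x, (Ustar 𝒰 φ T t x).Nonempty) ∧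
      (∀ t x, IsCompact (Ustar 𝒰 φ T t x)) ∧
      StableCond (Ustar 𝒰 φ T) ∧ StablePaste (Ustar 𝒰 φ T) ∧
      (ConvexVals 𝒰 → ConvexVals (Ustar 𝒰 φ T)) := by
  have := polish_path (F := F)
  obtain ⟨M, hM⟩ := hb
  obtain ⟨hfin, hU⟩ := Ustar_eq (𝒰 := 𝒰) hM husc.measurable T
  have hψ : Measurable fun y => ENNReal.ofReal (φ y + M) :=
    (husc.measurable.add_const M).ennreal_ofReal
  have hf : UpperSemicontinuous fun ω : C(ℝ≥0, F) => φ (ω T) + M :=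
    (husc.comp (continuous_eval_const T)).add upperSemicontinuous_const
  have hS : HCM fun p : ℝ≥0 × F =>
      Uopt 𝒰 (fun y => ENNReal.ofReal (φ y + M)) T p.1 p.2 :=
    hargm_HCM (S := fun p : ℝ≥0 × F => 𝒰 p.1 p.2)
      (J := Jl (fun y => ENNReal.ofReal (φ y + M)) T)
      (fun c => isClosed_superlevel_lintegral hf (B := M + M)
        (fun ω => by linarith [(abs_le.1 (hM (ω T))).1])
        (fun ω => by linarith [(abs_le.1 (hM (ω T))).2]) c)
      ⟨hmeas, fun p => hne _ _, fun p => hcpt _ _⟩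
  rw [hU]
  exact ⟨hS.1, fun t x => hS.2.1 (t, x), fun t x => hS.2.2 (t, x),
    Uopt_cond hcond hpaste hsupp hψ T hfin hS, Uopt_paste hcond hpaste hψ T,
    Uopt_convex T⟩

end Ustar

end NLSP
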